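/- Let M be a positive integer, let 0 < α ≤ 1/2, and let Y be a random variable with the binomial distribution with M trials and success probability α. Then for every z > 0, P( Y/M > (sqrt(α) + z)² ) ≤ exp( −2 M z² ). -/

import Mathlib

open MeasureTheory ProbabilityTheory

/-- `Y` has the binomial distribution with `M` trials and success probability `p`
under the probability measure `Q`. -/
def IsBinomial {Ω : Type*} [MeasurableSpace Ω] (Q : Measure Ω) (Y : Ω → ℕ)
    (M : ℕ) (p : ℝ) : Prop :=
  Measurable Y ∧ (∀ ω, Y ω ≤ M) ∧
    ∀ k : ℕ, Q {ω | Y ω = k} = ENNReal.ofReal ((M.choose k : ℝ) * p ^ k * (1 - p) ^ (M - k))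

/-- The second-order Taylor polynomial of `-log (1 - x)` is a lower bound on `[0, 1)`. -/
theorem add_sq_div_two_le_neg_log_one_sub {x : ℝ} (hx0 : 0 ≤ x) (hx1 : x < 1) :
    x + x ^ 2 / 2 ≤ -Real.log (1 - x) := by
  have hsum := Real.hasSum_pow_div_log_of_abs_lt_one (abs_lt.2 ⟨by linarith, hx1⟩)
  have h := sum_le_hasSum (Finset.range 2) (fun i _ => by positivity) hsum
  norm_num [Finset.sum_range_succ] at h
  linarith

/-- The Poisson relative entropy of `b ^ 2` with respect to `a ^ 2` dominates `2 * (b - a) ^ 2`. -/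
theorem two_mul_sub_sq_le_sq_mul_log {a b : ℝ} (ha : 0 < a) (hab : a ≤ b) :
    2 * (b - a) ^ 2 ≤ b ^ 2 * (2 * Real.log (b / a)) - (b ^ 2 - a ^ 2) := by
  have hb : 0 < b := ha.trans_le hab
  have h := add_sq_div_two_le_neg_log_one_sub (x := 1 - a / b)
    (sub_nonneg.2 ((div_le_one hb).2 hab)) (sub_lt_self 1 (div_pos ha hb))
  rw [sub_sub_cancel, ← Real.log_inv, inv_div] at h
  have h' := mul_le_mul_of_nonneg_left h (by positivity : 0 ≤ 2 * b ^ 2)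
  have e : 2 * b ^ 2 * (1 - a / b + (1 - a / b) ^ 2 / 2) = 2 * (b - a) ^ 2 + (b ^ 2 - a ^ 2) := by
    field_simp
    ring
  linarith

/-- Chernoff's bound for the upper tail of the binomial weights, with the moment generating
function of the binomial distribution bounded by that of the Poisson distribution. -/
theorem sum_binomial_weight_le_exp {p : ℝ} (hp0 : 0 ≤ p) (hp1 : p ≤ 1) {l : ℝ} (hl : 0 ≤ l)
    (M : ℕ) (c : ℝ) :
    ∑ k ∈ Finset.range (M + 1) with c < ((k : ℕ) : ℝ),
        (M.choose k : ℝ) * p ^ k * (1 - p) ^ (M - k)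
      ≤ Real.exp (M * (p * (Real.exp l - 1)) - l * c) := by
  have hq : 0 ≤ 1 - p := sub_nonneg.2 hp1
  calc
    _ ≤ ∑ k ∈ Finset.range (M + 1) with c < ((k : ℕ) : ℝ),
          (M.choose k : ℝ) * p ^ k * (1 - p) ^ (M - k) * Real.exp (l * (k - c)) := by
      refine Finset.sum_le_sum fun k hk => le_mul_of_one_le_right (by positivity) ?_
      exact Real.one_le_exp (mul_nonneg hl (sub_nonneg.2 (Finset.mem_filter.1 hk).2.le))
    _ ≤ ∑ k ∈ Finset.range (M + 1),
          (M.choose k : ℝ) * p ^ k * (1 - p) ^ (M - k) * Real.exp (l * (k - c)) :=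
      Finset.sum_le_sum_of_subset_of_nonneg (Finset.filter_subset _ _)
        fun k _ _ => by positivity
    _ = (p * Real.exp l + (1 - p)) ^ M * Real.exp (-(l * c)) := by
      rw [add_pow, Finset.sum_mul]
      refine Finset.sum_congr rfl fun k _ => ?_
      rw [mul_sub, sub_eq_add_neg (l * (k : ℝ)), Real.exp_add, mul_comm l (k : ℝ), Real.exp_nat_mul, mul_pow]
      ring
    _ ≤ Real.exp (p * (Real.exp l - 1)) ^ M * Real.exp (-(l * c)) := by
      gcongr
      linarith [Real.add_one_le_exp (p * (Real.exp l - 1))]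
    _ = _ := by rw [← Real.exp_nat_mul, ← Real.exp_add, ← sub_eq_add_neg]

/-- The upper tail of a binomial random variable is at most the sum of its weights there. -/
theorem IsBinomial.measure_lt_le {Ω : Type*} [MeasurableSpace Ω] {Q : Measure Ω} {Y : Ω → ℕ}
    {M : ℕ} {p : ℝ} (hY : IsBinomial Q Y M p) (hp0 : 0 ≤ p) (hp1 : p ≤ 1) (c : ℝ) :
    Q {ω | c < (Y ω : ℝ)} ≤ ENNReal.ofReal (∑ k ∈ Finset.range (M + 1) with c < ((k : ℕ) : ℝ),
      (M.choose k : ℝ) * p ^ k * (1 - p) ^ (M - k)) := by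
  obtain ⟨-, hle, hpmf⟩ := hY
  have hq : 0 ≤ 1 - p := sub_nonneg.2 hp1
  rw [ENNReal.ofReal_sum_of_nonneg fun k _ => by positivity]
  simp_rw [← hpmf]
  refine (measure_mono fun ω hω => ?_).trans (measure_biUnion_finset_le _ _)
  exact Set.mem_biUnion (Finset.mem_coe.2 (Finset.mem_filter.2
    ⟨Finset.mem_range.2 (Nat.lt_succ_of_le (hle ω)), hω⟩)) rfl

/-- Okamoto's exponential upper-tail bound for the square root of the binomial
proportion: if `Y ~ Binomial(M, α)` with `0 < α ≤ 1/2`, then for every `z > 0`,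
`P(Y/M > (√α + z)²) ≤ exp(−2 M z²)`. -/
theorem okamoto_upper_tail {Ω : Type*} [MeasurableSpace Ω] (Q : Measure Ω)
    [IsProbabilityMeasure Q] (M : ℕ) (hM : 0 < M) (α : ℝ)
    (hα0 : 0 < α) (hα : α ≤ 1 / 2)
    (Y : Ω → ℕ) (hY : IsBinomial Q Y M α) (z : ℝ) (hz : 0 < z) :
    Q {ω | (Real.sqrt α + z) ^ 2 < (Y ω : ℝ) / (M : ℝ)}
      ≤ ENNReal.ofReal (Real.exp (-2 * (M : ℝ) * z ^ 2)) := by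
  have hM' : (0 : ℝ) < M := Nat.cast_pos.2 hM
  have hα1 : α ≤ 1 := by linarith
  have ha : 0 < √α := Real.sqrt_pos.2 hα0
  have hsq : √α ^ 2 = α := Real.sq_sqrt hα0.le
  set b := √α + z with hb
  have hab : √α ≤ b := by linarith
  have hl : 0 ≤ 2 * Real.log (b / √α) :=
    mul_nonneg zero_le_two (Real.log_nonneg ((one_le_div ha).2 hab))
  have hexp : α * (Real.exp (2 * Real.log (b / √α)) - 1) = b ^ 2 - √α ^ 2 := by
    rw [two_mul, Real.exp_add, Real.exp_log (div_pos (ha.trans_le hab) ha), ← sq, div_pow, hsq]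
    field_simp
  simp_rw [lt_div_iff₀ hM']
  refine (hY.measure_lt_le hα0.le hα1 _).trans (ENNReal.ofReal_le_ofReal ?_)
  refine (sum_binomial_weight_le_exp hα0.le hα1 hl M _).trans (Real.exp_le_exp.2 ?_)
  rw [hexp]
  have h := mul_le_mul_of_nonneg_left (two_mul_sub_sq_le_sq_mul_log ha hab) hM'.le
  rw [show b - √α = z by rw [hb]; ring] at h
  linarith
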